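/- Let Σ = {a,b}, let n ≥ 2, and let w ∈ Σ* be a word of length n. Then the syntactic complexity of L = Σ* w Σ* satisfies n² ≤ σ(L) ≤ n² + 1 + (n−1)(n−2)/2. -/

import Mathlib

/-- The two-letter alphabet Σ = {a, b}. -/
inductive Letter : Type
  | a : Letter
  | b : Letter
deriving DecidableEq

/-- The syntactic (Myhill) congruence of a language L, as a setoid on Σ⁺. -/
def synSetoid (L : Set (List Letter)) : Setoid {u : List Letter // u ≠ []} where
  r u v := ∀ x y : List Letter, x ++ u.val ++ y ∈ L ↔ x ++ v.val ++ y ∈ L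
  iseqv := ⟨fun _ _ _ => Iff.rfl, fun h x y => (h x y).symm,
    fun h1 h2 x y => (h1 x y).trans (h2 x y)⟩

/-- The syntactic complexity of L: the cardinality of its syntactic semigroup Σ⁺/≈_L. -/
noncomputable def syntacticComplexity (L : Set (List Letter)) : ℕ :=
  Nat.card (Quotient (synSetoid L))

/-- The language Σ* w Σ* of all words containing w as a factor. -/
def factorLang (w : List Letter) : Set (List Letter) := {u : List Letter | w <:+: u}

/-- The set of inner factors of w: nonempty words u with w = t u s for nonempty t, s. -/
def innerFactors (w : List Letter) : Set (List Letter) :=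
  {u : List Letter | u ≠ [] ∧ ∃ t s : List Letter, t ≠ [] ∧ s ≠ [] ∧ w = t ++ u ++ s}

/-- i is the length of the longest proper prefix of w that is a suffix of u. -/
def IsP (w u : List Letter) (i : ℕ) : Prop :=
  i < w.length ∧ (∃ p, p <+: w ∧ p.length = i ∧ p <:+ u) ∧
    ∀ q, q <+: w → q.length < w.length → q <:+ u → q.length ≤ i

/-- j is the length of the longest proper suffix of w that is a prefix of u. -/
def IsS (w u : List Letter) (j : ℕ) : Prop :=
  j < w.length ∧ (∃ p, p <:+ w ∧ p.length = j ∧ p <+: u) ∧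
    ∀ q, q <:+ w → q.length < w.length → q <+: u → q.length ≤ j

theorem isS_reverse {w u : List Letter} {j : ℕ} (h : IsS w u j) :
    IsP w.reverse u.reverse j := by
  obtain ⟨h1, ⟨p, hp, hpl, hpu⟩, h3⟩ := h
  refine ⟨by simpa using h1, ⟨p.reverse, by simpa using hp, by simpa using hpl,
    by simpa using hpu⟩, fun q hq hl hqu => ?_⟩
  have := h3 q.reverse (by rw [← List.reverse_prefix]; simpa using hq) (by simpa using hl)
    (by rw [← List.reverse_suffix]; simpa using hqu)
  simpa using this

theorem isP_reverse {w u : List Letter} {j : ℕ} (h : IsP w u j) :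
    IsS w.reverse u.reverse j := by
  obtain ⟨h1, ⟨p, hp, hpl, hpu⟩, h3⟩ := h
  refine ⟨by simpa using h1, ⟨p.reverse, by simpa using hp, by simpa using hpl,
    by simpa using hpu⟩, fun q hq hl hqu => ?_⟩
  have := h3 q.reverse (by rw [← List.reverse_suffix]; simpa using hq) (by simpa using hl)
    (by rw [← List.reverse_prefix]; simpa using hqu)
  simpa using this

theorem exists_isP (w u : List Letter) (hw : w ≠ []) : ∃ i, IsP w u i := by
  classical
  have hpos : 0 < w.length := List.length_pos_iff.2 hw
  let S := (Finset.range w.length).filter (fun i => ∃ p, p <+: w ∧ p.length = i ∧ p <:+ u)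
  have hS : S.Nonempty := ⟨0, by
    simp only [S, Finset.mem_filter, Finset.mem_range]
    exact ⟨hpos, [], List.nil_prefix, rfl, List.nil_suffix⟩⟩
  have hm := S.max'_mem hS
  have hm2 := hm
  simp only [S, Finset.mem_filter, Finset.mem_range] at hm2
  refine ⟨S.max' hS, hm2.1, hm2.2, fun q hq hl hqu => S.le_max' _ ?_⟩
  simp only [S, Finset.mem_filter, Finset.mem_range]
  exact ⟨hl, q, hq, rfl, hqu⟩

theorem exists_isS (w u : List Letter) (hw : w ≠ []) : ∃ i, IsS w u i := by
  obtain ⟨i, hi⟩ := exists_isP w.reverse u.reverse (by simpa using hw)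
  exact ⟨i, by simpa using isP_reverse hi⟩

/-- The syntactic congruence on plain words. -/
def Cong (w u v : List Letter) : Prop :=
  ∀ x y : List Letter, w <:+: x ++ u ++ y ↔ w <:+: x ++ v ++ y

theorem Cong.reverse {w u v : List Letter} (h : Cong w u v) :
    Cong w.reverse u.reverse v.reverse := by
  intro x y
  have := h y.reverse x.reverse
  rw [← List.reverse_infix, ← List.reverse_infix (l₁ := w)] at this
  simpa using this

theorem infix_split {w x y : List Letter} (h : w <:+: x ++ y) :
    w <:+: x ∨ w <:+: y ∨
      ∃ l r, w = l ++ r ∧ l ≠ [] ∧ r ≠ [] ∧ l <:+ x ∧ r <+: y := by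
  rcases List.infix_append_iff.1 h with h | h | ⟨l, r, rfl, hl, hr⟩
  · exact Or.inl h
  · exact Or.inr (Or.inl h)
  · by_cases h1 : l = []
    · subst h1; exact Or.inr (Or.inl hr.isInfix)
    by_cases h2 : r = []
    · subst h2; left; simpa using hl.isInfix
    exact Or.inr (Or.inr ⟨l, r, rfl, h1, h2, hl, hr⟩)

theorem infix_join {l r x y : List Letter} (hl : l <:+ x) (hr : r <+: y) :
    l ++ r <:+: x ++ y :=
  List.infix_append_iff.2 (Or.inr (Or.inr ⟨l, r, rfl, hl, hr⟩))

theorem isP_le {w u v : List Letter} (h : Cong w u v) (hv : ¬ w <:+: v)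
    {i j : ℕ} (hi : IsP w u i) (hj : IsP w v j) : i ≤ j := by
  by_contra hlt
  obtain ⟨hi1, ⟨p, ⟨y, rfl⟩, rfl, hpu⟩, -⟩ := hi
  have h1 : p ++ y <:+: [] ++ u ++ y := infix_join hpu (List.prefix_refl y)
  rw [h] at h1
  rcases infix_split (by simpa using h1) with h2 | h2 | ⟨l, r, he, hl, hr, hlv, hry⟩
  · exact hv h2
  · have := h2.length_le
    simp at this
    subst this
    simp at hlt
  · have := hj.2.2 l ⟨r, he.symm⟩ (by
      rw [he]; have := List.length_pos_iff.2 hr; simp; omega) hlv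
    have h3 := hry.length_le
    have h4 := congrArg List.length he
    simp at h4
    omega

theorem isP_unique {w u v : List Letter} (h : Cong w u v) (hu : ¬ w <:+: u) (hv : ¬ w <:+: v)
    {i j : ℕ} (hi : IsP w u i) (hj : IsP w v j) : i = j :=
  le_antisymm (isP_le h hv hi hj) (isP_le (fun x y => (h x y).symm) hu hj hi)

theorem isS_unique {w u v : List Letter} (h : Cong w u v) (hu : ¬ w <:+: u) (hv : ¬ w <:+: v)
    {i j : ℕ} (hi : IsS w u i) (hj : IsS w v j) : i = j :=
  isP_unique h.reverse (by simpa using hu) (by simpa using hv) (isS_reverse hi) (isS_reverse hj)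

/-! Upper bound -/

theorem cong_of_pair {w u v : List Letter} (hu0 : u ≠ []) (hu : ¬ w <:+: u)
    (hin : u ∉ innerFactors w) {i j : ℕ} (hPu : IsP w u i) (hSu : IsS w u j)
    (hPv : IsP w v i) (hSv : IsS w v j) (x y : List Letter) (h : w <:+: x ++ u ++ y) :
    w <:+: x ++ v ++ y := by
  rw [List.append_assoc] at h
  rcases infix_split h with h | h | ⟨l, r, rfl, hl, hr, hlx, hry⟩
  · rw [List.append_assoc]; exact List.infix_append_iff.2 (Or.inl h)
  · rcases infix_split h with h | h | ⟨l, r, rfl, hl, hr, hlx, hry⟩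
    · exact absurd h hu
    · exact List.infix_append_iff.2 (Or.inr (Or.inl h))
    · refine infix_join ?_ hry
      have hle := hPu.2.2 l (List.prefix_append _ _)
        (by have := List.length_pos_iff.2 hr; simp; omega) hlx
      obtain ⟨p, hp, hpl, hpv⟩ := hPv.2.1
      obtain ⟨p', hp', hpl', hpu⟩ := hPu.2.1
      have e : p = p' := by
        rw [List.prefix_iff_eq_take.1 hp, List.prefix_iff_eq_take.1 hp', hpl, hpl']
      subst e
      have : l <:+ p := List.suffix_of_suffix_length_le hlx hpu (by omega)
      exact (this.trans hpv).trans (List.suffix_append _ _)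
  · rw [List.append_assoc]
    refine infix_join hlx ?_
    by_cases hc : r.length ≤ u.length
    · have hru : r <+: u := List.prefix_of_prefix_length_le hry (List.prefix_append _ _) hc
      have hle := hSu.2.2 r (List.suffix_append _ _)
        (by have := List.length_pos_iff.2 hl; simp; omega) hru
      obtain ⟨p, hp, hpl, hpv⟩ := hSv.2.1
      obtain ⟨p', hp', hpl', hpu⟩ := hSu.2.1
      have e : p = p' := by
        rw [List.suffix_iff_eq_drop.1 hp, List.suffix_iff_eq_drop.1 hp', hpl, hpl']
      subst e
      have : r <+: p := List.prefix_of_prefix_length_le hru hpu (by omega)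
      exact (this.trans hpv).trans (List.prefix_append _ _)
    · exfalso
      obtain ⟨t, rfl⟩ : u <+: r :=
        List.prefix_of_prefix_length_le (List.prefix_append _ _) hry (by omega)
      apply hin
      refine ⟨hu0, l, t, hl, ?_, by simp⟩
      rintro rfl
      simp at hc

/-- Codes for the congruence classes. -/
abbrev Code (n : ℕ) : Type := (Fin n × Fin n) ⊕ Unit ⊕ (Σ e : Fin (n - 1), Fin e)

/-- The relation between codes and words. -/
def Codes (w : List Letter) (n : ℕ) : Code n → List Letter → Prop
  | Sum.inl (i, j), u => ¬ w <:+: u ∧ u ∉ innerFactors w ∧ IsP w u i ∧ IsS w u j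
  | Sum.inr (Sum.inl _), u => w <:+: u
  | Sum.inr (Sum.inr ⟨e, b⟩), u => u = (w.take (e + 1)).drop (b + 1)

theorem exists_code (w : List Letter) (n : ℕ) (hw : w.length = n) (hn : 2 ≤ n)
    (u : List Letter) : ∃ c, Codes w n c u := by
  subst hw
  have hw0 : w ≠ [] := by rintro rfl; simp at hn
  by_cases h1 : w <:+: u
  · exact ⟨Sum.inr (Sum.inl ()), h1⟩
  by_cases h2 : u ∈ innerFactors w
  · obtain ⟨hu, t, s, ht, hs, he⟩ := h2
    have h3 := congrArg List.length he
    have hu' := List.length_pos_iff.2 hu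
    have ht' := List.length_pos_iff.2 ht
    have hs' := List.length_pos_iff.2 hs
    simp at h3
    refine ⟨Sum.inr (Sum.inr ⟨⟨t.length + u.length - 1, by omega⟩,
      ⟨t.length - 1, by show t.length - 1 < t.length + u.length - 1; omega⟩⟩), ?_⟩
    show u = (w.take (t.length + u.length - 1 + 1)).drop (t.length - 1 + 1)
    rw [show t.length + u.length - 1 + 1 = (t ++ u).length by simp; omega,
      show t.length - 1 + 1 = t.length by omega, he, List.take_left, List.drop_left]
  · obtain ⟨i, hi⟩ := exists_isP w u hw0
    obtain ⟨j, hj⟩ := exists_isS w u hw0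
    exact ⟨Sum.inl (⟨i, hi.1⟩, ⟨j, hj.1⟩), h1, h2, hi, hj⟩

theorem code_cong (w : List Letter) (n : ℕ) (c : Code n) (u v : List Letter)
    (hu0 : u ≠ []) (hv0 : v ≠ []) (hu : Codes w n c u) (hv : Codes w n c v) : Cong w u v := by
  rcases c with ⟨i, j⟩ | _ | ⟨e, b⟩
  · obtain ⟨h1, h2, h3, h4⟩ := hu
    obtain ⟨g1, g2, g3, g4⟩ := hv
    exact fun x y => ⟨cong_of_pair hu0 h1 h2 h3 h4 g3 g4 x y,
      cong_of_pair hv0 g1 g2 g3 g4 h3 h4 x y⟩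
  · have hu' : w <:+: u := hu
    have hv' : w <:+: v := hv
    exact fun x y => ⟨fun _ => hv'.trans (List.infix_append _ _ _),
      fun _ => hu'.trans (List.infix_append _ _ _)⟩
  · have hu' : u = (w.take (e + 1)).drop (b + 1) := hu
    have hv' : v = (w.take (e + 1)).drop (b + 1) := hv
    rw [hu', hv']
    exact fun x y => Iff.rfl

theorem upper (w : List Letter) (n : ℕ) (hw : w.length = n) (hn : 2 ≤ n) :
    Finite (Quotient (synSetoid (factorLang w))) ∧
    Nat.card (Quotient (synSetoid (factorLang w))) ≤ n ^ 2 + 1 + (n - 1) * (n - 2) / 2 := by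
  choose f hf using exists_code w n hw hn
  have hinj : Function.Injective
      (fun q : Quotient (synSetoid (factorLang w)) => f q.out.val) := by
    intro q q' h
    rw [← Quotient.out_equiv_out]
    have h' : f q.out.val = f q'.out.val := h
    have h2 := hf q'.out.val
    rw [← h'] at h2
    exact code_cong w n _ _ _ q.out.2 q'.out.2 (hf _) h2
  refine ⟨Finite.of_injective _ hinj, (Nat.card_le_card_of_injective _ hinj).trans ?_⟩
  have hs : ∑ e : Fin (n - 1), (e : ℕ) = (n - 1) * (n - 2) / 2 := by
    rw [Fin.sum_univ_eq_sum_range (fun i => i), Finset.sum_range_id]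
    rfl
  simp only [Nat.card_eq_fintype_card, Fintype.card_sum, Fintype.card_prod, Fintype.card_fin,
    Fintype.card_sigma, Fintype.card_unit, hs]
  nlinarith

/-! Lower bound -/

theorem le_of_suffix_rep {c d : Letter} (hcd : c ≠ d) {q p : List Letter} {N : ℕ}
    (hq : ∀ x t, q = x :: t → x = c) (h : q <:+ List.replicate N d ++ p) :
    q.length ≤ p.length := by
  by_contra hlt
  obtain ⟨t, rfl⟩ : p <:+ q :=
    List.suffix_of_suffix_length_le (List.suffix_append _ _) h (by omega)
  obtain ⟨t', ht'⟩ := h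
  rw [← List.append_assoc] at ht'
  have h1 := List.append_cancel_right ht'
  have h2 : t <:+ List.replicate N d := ⟨t', h1⟩
  cases t with
  | nil => simp at hlt
  | cons x t =>
    have := hq x (t ++ p) rfl
    subst this
    have : x ∈ List.replicate N d := h2.subset (by simp)
    exact hcd (List.eq_of_mem_replicate this)

theorem head_of_prefix {c : Letter} {w0 q : List Letter} (h : q <+: c :: w0) :
    ∀ x t, q = x :: t → x = c := by
  rintro x t rfl
  obtain ⟨r, hr⟩ := h
  simp at hr
  exact hr.1

theorem key {c d : Letter} (hcd : c ≠ d) {v s : List Letter} {l r : ℕ}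
    (hs : s <:+ v ++ c :: List.replicate l d) (hl : l ≤ s.length) (hr : 1 ≤ r) :
    ¬ (c :: List.replicate l d <:+ s ++ List.replicate r d) := by
  intro h
  have h1 : List.replicate l d <:+ s := by
    refine List.suffix_of_suffix_length_le (l₃ := v ++ c :: List.replicate l d) ?_ hs (by simpa)
    exact ⟨v ++ [c], by simp⟩
  have h2 : List.replicate l d ++ List.replicate r d <:+ s ++ List.replicate r d := by
    obtain ⟨t, rfl⟩ := h1
    exact ⟨t, by simp⟩
  have h3 := List.suffix_of_suffix_length_le h h2 (by simp; omega)
  rw [← List.replicate_add] at h3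
  have : c ∈ List.replicate (l + r) d := h3.subset (by simp)
  exact hcd (List.eq_of_mem_replicate this)

theorem realize_one {c d : Letter} (hcd : c ≠ d) {w w0 v : List Letter} {l i j : ℕ}
    (h0 : w = c :: w0) (h1 : w = v ++ c :: List.replicate l d) (hi : i < w.length)
    (hj : j < w.length) (hl : l ≤ j) :
    ∃ u, u ≠ [] ∧ ¬ w <:+: u ∧ IsP w u i ∧ IsS w u j := by
  obtain ⟨p, hp, hpl⟩ : ∃ p, p <+: w ∧ p.length = i :=
    ⟨w.take i, List.take_prefix _ _, by simp; omega⟩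
  obtain ⟨s, hs, hsl⟩ : ∃ s, s <:+ w ∧ s.length = j :=
    ⟨w.drop (w.length - j), List.drop_suffix _ _, by simp; omega⟩
  have hcw : c :: List.replicate l d <:+ w := ⟨v, h1.symm⟩
  have hkey : ∀ r, 1 ≤ r → ¬ (c :: List.replicate l d <:+ s ++ List.replicate r d) :=
    fun r hr => key hcd (h1 ▸ hs) (by omega) hr
  have hkey2 : ∀ q, c :: List.replicate l d <:+ q → q <+: s ++ List.replicate w.length d →
      q.length ≤ j := by
    intro q hq hqs
    by_contra hlt
    obtain ⟨t, rfl⟩ : s <+: q :=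
      List.prefix_of_prefix_length_le (List.prefix_append _ _) hqs (by omega)
    obtain ⟨t', ht'⟩ := hqs
    rw [List.append_assoc] at ht'
    have h4 : t <+: List.replicate w.length d := ⟨t', List.append_cancel_left ht'⟩
    rw [List.prefix_replicate_iff] at h4
    rw [h4.2] at hq
    refine hkey _ ?_ hq
    simp at hlt
    omega
  refine ⟨s ++ List.replicate w.length d ++ p, ?_, ?_, ?_, ?_⟩
  · have : w.length ≠ 0 := by omega
    intro h
    have := congrArg List.length h
    simp only [List.length_append, List.length_replicate, List.length_nil] at this
    omega
  · intro h
    rcases infix_split h with h | h | ⟨a, b, he, ha, hb, hla, hrb⟩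
    · obtain ⟨x, y, hxy⟩ := h
      have := hkey2 (x ++ w) (hcw.trans (List.suffix_append _ _)) ⟨y, hxy⟩
      simp at this
      omega
    · have := h.length_le
      omega
    · have hlen := congrArg List.length he
      simp at hlen
      have hb' := List.length_pos_iff.2 hb
      have h5 : a <:+ List.replicate w.length d :=
        List.suffix_of_suffix_length_le hla (List.suffix_append _ _) (by simp; omega)
      have h6 := le_of_suffix_rep hcd (q := a) (p := []) (N := w.length)
        (head_of_prefix (w0 := w0) ⟨b, by rw [← he, h0]⟩) (by simpa using h5)
      exact ha (by simpa using h6)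
  · refine ⟨hi, ⟨p, hp, hpl, List.suffix_append _ _⟩, fun q hq hlq hqu => ?_⟩
    rw [List.append_assoc] at hqu
    have h5 : q <:+ List.replicate w.length d ++ p :=
      List.suffix_of_suffix_length_le hqu (List.suffix_append _ _) (by simp; omega)
    rw [← hpl]
    exact le_of_suffix_rep hcd (head_of_prefix (h0 ▸ hq)) h5
  · refine ⟨hj, ⟨s, hs, hsl, by simp⟩, fun q hq hlq hqu => ?_⟩
    have h5 : q <+: s ++ List.replicate w.length d :=
      List.prefix_of_prefix_length_le hqu (List.prefix_append _ _) (by simp; omega)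
    by_contra hlt
    refine hlt (hkey2 q ?_ h5)
    exact List.suffix_of_suffix_length_le hcw hq (by simp; omega)

theorem last_decomp {c d : Letter} (hall : ∀ x : Letter, x = c ∨ x = d) (w : List Letter)
    (hc : c ∈ w) : ∃ v l, w = v ++ c :: List.replicate l d := by
  induction w using List.reverseRecOn with
  | nil => simp at hc
  | append_singleton w x ih =>
    rcases hall x with rfl | rfl
    · exact ⟨w, 0, by simp⟩
    · by_cases hx : c = x
      · subst hx
        exact ⟨w, 0, by simp⟩
      · obtain ⟨v, l, rfl⟩ := ih (by simpa [hx] using hc)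
        exact ⟨v, l + 1, by simp [List.replicate_succ']⟩

theorem isP_rep {c d : Letter} (hcd : c ≠ d) {w w0 : List Letter} {i j k : ℕ} (h0 : w = c :: w0)
    (hk : List.replicate k c <+: w) (hik : i < k) :
    IsP w (List.replicate j d ++ List.replicate i c) i := by
  have := hk.length_le
  simp at this
  refine ⟨by omega, ⟨List.replicate i c, ?_, by simp, List.suffix_append _ _⟩,
    fun q hq hlq hqu => ?_⟩
  · refine List.IsPrefix.trans ⟨List.replicate (k - i) c, ?_⟩ hk
    rw [← List.replicate_add]
    congr 1
    omega
  · simpa using le_of_suffix_rep hcd (head_of_prefix (h0 ▸ hq)) hqu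

theorem realize (w : List Letter) (i j : ℕ) (hi : i < w.length) (hj : j < w.length)
    (hij : i ≠ 0 ∨ j ≠ 0) :
    ∃ u, u ≠ [] ∧ ¬ w <:+: u ∧ IsP w u i ∧ IsS w u j := by
  cases hw : w with
  | nil => subst hw; simp at hi
  | cons c w0 =>
  rw [← hw]
  obtain ⟨d, hcd, hall⟩ : ∃ d : Letter, c ≠ d ∧ ∀ x : Letter, x = c ∨ x = d := by
    cases c
    · exact ⟨Letter.b, by decide, fun x => by cases x <;> simp⟩
    · exact ⟨Letter.a, by decide, fun x => by cases x <;> simp⟩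
  obtain ⟨v, l, h1⟩ := last_decomp hall w (by simp [hw])
  by_cases hl : l ≤ j
  · exact realize_one hcd hw h1 hi hj hl
  obtain ⟨m, rfl⟩ : ∃ m, l = m + 1 := ⟨l - 1, by omega⟩
  have hrev : w.reverse = d :: (List.replicate m d ++ c :: v.reverse) := by
    rw [h1]
    rw [List.reverse_append, List.reverse_cons, List.reverse_replicate, List.replicate_succ]
    simp
  obtain ⟨v', k, h2⟩ := last_decomp (fun x => (hall x).symm) w.reverse (by simp [hrev])
  by_cases hk : k ≤ i
  · obtain ⟨u, hu0, hu, hP, hS⟩ := realize_one hcd.symm hrev h2 (i := j) (j := i)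
      (by simpa using hj) (by simpa using hi) hk
    refine ⟨u.reverse, by simpa using hu0, ?_, ?_, ?_⟩
    · rw [← List.reverse_infix]; simpa using hu
    · simpa using isS_reverse hS
    · simpa using isP_reverse hP
  have h3 : w = List.replicate k c ++ d :: v'.reverse := by
    rw [← List.reverse_reverse w, h2]; simp
  have hdw : d ∈ w := by rw [h3]; simp
  refine ⟨List.replicate j d ++ List.replicate i c, ?_, ?_, ?_, ?_⟩
  · simp; tauto
  · intro h
    rcases infix_split h with h | h | ⟨a, b, he, ha, hb, hla, hrb⟩
    · exact hcd (List.eq_of_mem_replicate (h.subset (by simp [hw] : c ∈ w)))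
    · exact hcd (List.eq_of_mem_replicate (h.subset hdw)).symm
    · have h6 := le_of_suffix_rep hcd (q := a) (p := []) (N := j)
        (head_of_prefix (w0 := w0) ⟨b, by rw [← he, hw]⟩) (by simpa using hla)
      exact ha (by simpa using h6)
  · exact isP_rep hcd hw ⟨_, h3.symm⟩ (by omega)
  · have h7 := isP_rep (j := i) (i := j) hcd.symm hrev (k := m + 1)
      ⟨c :: v.reverse, by rw [hrev]; simp [List.replicate_succ]⟩ (by omega)
    simpa using isP_reverse h7

theorem lower (w : List Letter) (n : ℕ) (hw : w.length = n) (hn : 2 ≤ n)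
    [Finite (Quotient (synSetoid (factorLang w)))] :
    n ^ 2 ≤ Nat.card (Quotient (synSetoid (factorLang w))) := by
  subst hw
  have hex : ∀ ij : Fin w.length × Fin w.length, ∃ u : {u : List Letter // u ≠ []},
      ((ij.1 : ℕ) = 0 ∧ (ij.2 : ℕ) = 0 ∧ w <:+: u.val) ∨
      (((ij.1 : ℕ) ≠ 0 ∨ (ij.2 : ℕ) ≠ 0) ∧ ¬ w <:+: u.val ∧ IsP w u.val ij.1 ∧ IsS w u.val ij.2) := by
    rintro ⟨i, j⟩
    by_cases h : (i : ℕ) ≠ 0 ∨ (j : ℕ) ≠ 0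
    · obtain ⟨u, hu, h'⟩ := realize w i j i.2 j.2 h
      exact ⟨⟨u, hu⟩, Or.inr ⟨h, h'⟩⟩
    · push Not at h
      exact ⟨⟨w, by rintro rfl; simp at hn⟩, Or.inl ⟨h.1, h.2, List.infix_refl _⟩⟩
  choose f hf using hex
  have hinj : Function.Injective (fun ij => Quotient.mk (synSetoid (factorLang w)) (f ij)) := by
    intro p q h
    have hc : Cong w (f p).val (f q).val := Quotient.exact h
    have hiff : w <:+: (f p).val ↔ w <:+: (f q).val := by simpa using hc [] []
    rcases hf p with ⟨h1, h2, h3⟩ | ⟨h0, h1, h2, h3⟩ <;>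
      rcases hf q with ⟨g1, g2, g3⟩ | ⟨g0, g1, g2, g3⟩
    · exact Prod.ext (Fin.ext (by omega)) (Fin.ext (by omega))
    · exact absurd (hiff.1 h3) g1
    · exact absurd (hiff.2 g3) h1
    · exact Prod.ext (Fin.ext (isP_unique hc h1 g1 h2 g2)) (Fin.ext (isS_unique hc h1 g1 h3 g3))
  have := Nat.card_le_card_of_injective _ hinj
  simpa [sq] using this

/-- For n ≥ 2 and w of length n over Σ = {a,b}, the syntactic complexity of
L = Σ* w Σ* satisfies n² ≤ σ(L) ≤ n² + 1 + (n−1)(n−2)/2. -/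
theorem stmt16 (n : ℕ) (hn : 2 ≤ n) (w : List Letter) (hlen : w.length = n) :
    n ^ 2 ≤ syntacticComplexity (factorLang w) ∧
      syntacticComplexity (factorLang w) ≤ n ^ 2 + 1 + (n - 1) * (n - 2) / 2 := by
  obtain ⟨hfin, hup⟩ := upper w n hlen hn
  exact ⟨lower w n hlen hn, hup⟩
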